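/- Let Y ⊆ ℝ^p be nonempty and compact, X ⊆ ℝ^d, and let S : X ⇉ Y be a set-valued map with nonempty convex compact values; write d_x for the affine dimension of S(x). Let ρ : X × Y → [0,∞) be continuous with 0 < ∫_{S(x)} ρ(x,y) dλ_{d_x}(y) < ∞ for all x, and define the conditional belief β_x(A) = (∫_{A∩S(x)} ρ(x,y) dλ_{d_x}(y))/(∫_{S(x)} ρ(x,y) dλ_{d_x}(y)) for Borel A ⊆ Y. If S is rectangularly continuous at x̄ ∈ X (and in particular continuous at x̄), then β is weak continuous at x̄: for every sequence x_n → x̄ in X, β_{x_n} converges weakly to β_{x̄}. In particular, the Neutral belief over S (the case ρ ≡ 1) is weak continuous at x̄. -/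

import Mathlib

open MeasureTheory Filter Topology Set Pointwise
open scoped ENNReal

/-- The affine dimension of a set: the dimension of its affine hull. -/
noncomputable def adim {p : ℕ} (A : Set (EuclideanSpace ℝ (Fin p))) : ℕ :=
  Module.finrank ℝ (affineSpan ℝ A).direction

/-- `Lim_{x→xb, x∈X} F(x) = C` in the sense of Kuratowski, via sequences. -/
def KuratowskiTendsto {d p : ℕ} (X : Set (EuclideanSpace ℝ (Fin d)))
    (F : EuclideanSpace ℝ (Fin d) → Set (EuclideanSpace ℝ (Fin p)))
    (xb : EuclideanSpace ℝ (Fin d)) (C : Set (EuclideanSpace ℝ (Fin p))) : Prop :=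
  (∀ (xn : ℕ → EuclideanSpace ℝ (Fin d)) (yn : ℕ → EuclideanSpace ℝ (Fin p))
      (y : EuclideanSpace ℝ (Fin p)),
    (∀ n, xn n ∈ X) → Tendsto xn atTop (𝓝 xb) → (∀ n, yn n ∈ F (xn n)) →
      Tendsto yn atTop (𝓝 y) → y ∈ C) ∧
  (∀ y ∈ C, ∀ xn : ℕ → EuclideanSpace ℝ (Fin d), (∀ n, xn n ∈ X) →
    Tendsto xn atTop (𝓝 xb) →
    ∃ yn : ℕ → EuclideanSpace ℝ (Fin p), (∀ n, yn n ∈ F (xn n)) ∧ Tendsto yn atTop (𝓝 y))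

/-- Rectangular continuity of a set-valued map `S : X ⇉ ℝ^p` at `xb` (Definition 3.3). -/
def RectangularlyContinuousAt {d p : ℕ} (X : Set (EuclideanSpace ℝ (Fin d)))
    (S : EuclideanSpace ℝ (Fin d) → Set (EuclideanSpace ℝ (Fin p)))
    (xb : EuclideanSpace ℝ (Fin d)) : Prop :=
  ∃ T₀ T₁ R₀ R₁ : EuclideanSpace ℝ (Fin d) → Set (EuclideanSpace ℝ (Fin p)),
    (∀ᶠ x in 𝓝[X] xb, T₀ x + R₀ x ⊆ S x ∧ S x ⊆ T₁ x + R₁ x) ∧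
    (∀ x ∈ X,
      R₀ x ⊆ ((Submodule.span ℝ (T₀ x - T₀ x))ᗮ : Set (EuclideanSpace ℝ (Fin p))) ∩
          (Submodule.span ℝ (S x - S x) : Set (EuclideanSpace ℝ (Fin p))) ∧
      R₁ x ⊆ ((Submodule.span ℝ (T₁ x - T₁ x))ᗮ : Set (EuclideanSpace ℝ (Fin p))) ∩
          (Submodule.span ℝ (S x - S x) : Set (EuclideanSpace ℝ (Fin p))) ∧
      adim (T₀ x) = adim (S xb) ∧ adim (T₁ x) = adim (S xb)) ∧
    KuratowskiTendsto X R₀ xb {0} ∧ KuratowskiTendsto X R₁ xb {0} ∧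
    KuratowskiTendsto X T₀ xb (S xb) ∧ KuratowskiTendsto X T₁ xb (S xb) ∧
    (∀ x ∈ X, MeasurableSet (R₀ x) ∧ MeasurableSet (R₁ x)) ∧
    Tendsto (fun x => (μH[((adim (S x) - adim (S xb) : ℕ) : ℝ)] (R₀ x)).toReal /
        (μH[((adim (S x) - adim (S xb) : ℕ) : ℝ)] (R₁ x)).toReal) (𝓝[X] xb) (𝓝 1)

/-- The conditional belief with density `ρ` w.r.t. the `adim (S x)`-dimensional
Hausdorff (Lebesgue) measure:
`β_x(A) = (∫_{A∩S(x)} ρ(x,y) dλ_{d_x}(y)) / (∫_{S(x)} ρ(x,y) dλ_{d_x}(y))`. -/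
noncomputable def condBelief {d p : ℕ}
    (S : EuclideanSpace ℝ (Fin d) → Set (EuclideanSpace ℝ (Fin p)))
    (ρ : EuclideanSpace ℝ (Fin d) → EuclideanSpace ℝ (Fin p) → ℝ)
    (x : EuclideanSpace ℝ (Fin d)) : Measure (EuclideanSpace ℝ (Fin p)) :=
  (∫⁻ y in S x, ENNReal.ofReal (ρ x y) ∂(μH[(adim (S x) : ℝ)]))⁻¹ •
    ((μH[(adim (S x) : ℝ)] : Measure (EuclideanSpace ℝ (Fin p))).restrict (S x)).withDensity
      fun y => ENNReal.ofReal (ρ x y)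

/-! ### Hausdorff measure of orthogonal sums -/

theorem exists_hausdorffMeasure_toLp_prod (d k : ℕ) : ∃ κ : ℝ≥0∞, κ ≠ 0 ∧ κ ≠ ⊤ ∧
    ∀ (A : Set (EuclideanSpace ℝ (Fin d))) (B : Set (EuclideanSpace ℝ (Fin k))),
      μH[((d + k : ℕ) : ℝ)] (WithLp.toLp 2 '' A ×ˢ B) = κ * (μH[(d : ℝ)] A * μH[(k : ℝ)] B) := by
  have hd : (μH[(d : ℝ)] : Measure (EuclideanSpace ℝ (Fin d))).IsAddHaarMeasure := by
    simpa using isAddHaarMeasure_hausdorffMeasure (E := EuclideanSpace ℝ (Fin d))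
  have hk : (μH[(k : ℝ)] : Measure (EuclideanSpace ℝ (Fin k))).IsAddHaarMeasure := by
    simpa using isAddHaarMeasure_hausdorffMeasure (E := EuclideanSpace ℝ (Fin k))
  let L := WithLp 2 (EuclideanSpace ℝ (Fin d) × EuclideanSpace ℝ (Fin k))
  let e : L ≃L[ℝ] EuclideanSpace ℝ (Fin d) × EuclideanSpace ℝ (Fin k) :=
    WithLp.prodContinuousLinearEquiv 2 ℝ _ _
  have hL : (μH[((d + k : ℕ) : ℝ)] : Measure L).IsAddHaarMeasure := by
    have hf : Module.finrank ℝ L = d + k := by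
      rw [e.toLinearEquiv.finrank_eq]
      simp
    rw [← hf]
    exact isAddHaarMeasure_hausdorffMeasure (E := L)
  have hm : (((μH[(d : ℝ)] : Measure (EuclideanSpace ℝ (Fin d))).prod
      (μH[(k : ℝ)] : Measure (EuclideanSpace ℝ (Fin k)))).map e.symm).IsAddHaarMeasure :=
    e.symm.isAddHaarMeasure_map _
  obtain ⟨c, hc⟩ : ∃ c : ℝ≥0∞, c = Measure.addHaarScalarFactor (μH[((d + k : ℕ) : ℝ)] : Measure L)
    (((μH[(d : ℝ)] : Measure (EuclideanSpace ℝ (Fin d))).prod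
      (μH[(k : ℝ)] : Measure (EuclideanSpace ℝ (Fin k)))).map e.symm) := ⟨_, rfl⟩
  refine ⟨c, ?_, ?_, fun A B ↦ ?_⟩
  · rw [hc]
    exact_mod_cast (Measure.addHaarScalarFactor_pos_of_isAddHaarMeasure _ _).ne'
  · simp [hc]
  · have h := Measure.isAddLeftInvariant_eq_smul (μH[((d + k : ℕ) : ℝ)] : Measure L)
      (((μH[(d : ℝ)] : Measure (EuclideanSpace ℝ (Fin d))).prod
      (μH[(k : ℝ)] : Measure (EuclideanSpace ℝ (Fin k)))).map e.symm)
    have h2 : (((μH[(d : ℝ)] : Measure (EuclideanSpace ℝ (Fin d))).prod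
      (μH[(k : ℝ)] : Measure (EuclideanSpace ℝ (Fin k)))).map e.symm) (e.symm '' A ×ˢ B) =
        μH[(d : ℝ)] A * μH[(k : ℝ)] B := by
      have h3 := e.symm.toHomeomorph.toMeasurableEquiv.map_apply
        (μ := (μH[(d : ℝ)] : Measure (EuclideanSpace ℝ (Fin d))).prod
          (μH[(k : ℝ)] : Measure (EuclideanSpace ℝ (Fin k)))) (e.symm '' A ×ˢ B)
      refine h3.trans ?_
      have h4 : e.symm.toHomeomorph.toMeasurableEquiv ⁻¹' (e.symm '' A ×ˢ B) = A ×ˢ B :=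
        preimage_image_eq _ e.symm.injective
      rw [h4, Measure.prod_prod]
    rw [← h2, hc]
    exact DFunLike.congr_fun h _

theorem exists_linearIsometry_range_eq {E : Type*} [NormedAddCommGroup E] [InnerProductSpace ℝ E]
    [FiniteDimensional ℝ E] {d : ℕ} (W : Submodule ℝ E) (hW : Module.finrank ℝ W = d) :
    ∃ i : EuclideanSpace ℝ (Fin d) →ₗᵢ[ℝ] E, LinearMap.range i.toLinearMap = W := by
  subst hW
  refine ⟨W.subtypeₗᵢ.comp (stdOrthonormalBasis ℝ W).repr.symm.toLinearIsometry, ?_⟩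
  ext x
  constructor
  · rintro ⟨a, rfl⟩
    exact Subtype.prop _
  · intro hx
    refine ⟨(stdOrthonormalBasis ℝ W).repr ⟨x, hx⟩, ?_⟩
    simp

theorem isometry_const_add_linearIsometry {E F : Type*} [NormedAddCommGroup E] [NormedSpace ℝ E]
    [NormedAddCommGroup F] [NormedSpace ℝ F]
    (i : F →ₗᵢ[ℝ] E) (t : E) : Isometry fun a ↦ t + i a :=
  (isometry_add_left t).comp i.isometry

theorem exists_hausdorffMeasure_add (d k : ℕ) : ∃ κ : ℝ≥0∞, κ ≠ 0 ∧ κ ≠ ⊤ ∧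
    ∀ {p : ℕ} (W U : Submodule ℝ (EuclideanSpace ℝ (Fin p))) (t : EuclideanSpace ℝ (Fin p))
      (T R : Set (EuclideanSpace ℝ (Fin p))),
      Module.finrank ℝ W = d → Module.finrank ℝ U = k → U ≤ Wᗮ → (∀ y ∈ T, y - t ∈ W) →
      (∀ y ∈ R, y ∈ U) → μH[((d + k : ℕ) : ℝ)] (T + R) = κ * (μH[(d : ℝ)] T * μH[(k : ℝ)] R) := by
  obtain ⟨κ, h0, h1, h⟩ := exists_hausdorffMeasure_toLp_prod d k
  refine ⟨κ, h0, h1, fun {p} W U t T R hW hU hWU hT hR ↦ ?_⟩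
  obtain ⟨i, hi⟩ := exists_linearIsometry_range_eq W hW
  obtain ⟨j, hj⟩ := exists_linearIsometry_range_eq U hU
  have hTi : (fun a ↦ t + i a) '' {a | t + i a ∈ T} = T := by
    ext y
    constructor
    · rintro ⟨a, ha, rfl⟩
      exact ha
    · intro hy
      obtain ⟨a, ha⟩ : y - t ∈ LinearMap.range i.toLinearMap := hi ▸ hT y hy
      have : t + i a = y := by
        rw [← add_sub_cancel t y]
        exact congrArg _ ha
      exact ⟨a, by simpa [this] using hy, this⟩
  have hRj : j '' {b | j b ∈ R} = R := by
    ext y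
    constructor
    · rintro ⟨a, ha, rfl⟩
      exact ha
    · intro hy
      obtain ⟨a, ha⟩ : y ∈ LinearMap.range j.toLinearMap := hj ▸ hR y hy
      exact ⟨a, by simpa [← ha] using hy, ha⟩
  let Φ : WithLp 2 (EuclideanSpace ℝ (Fin d) × EuclideanSpace ℝ (Fin k)) →
    EuclideanSpace ℝ (Fin p) := fun z ↦ t + i z.fst + j z.snd
  have hΦ : Isometry Φ := by
    refine Isometry.of_dist_eq fun z w ↦ ?_
    rw [dist_eq_norm, dist_eq_norm, ← sq_eq_sq₀ (norm_nonneg _) (norm_nonneg _),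
      WithLp.prod_norm_sq_eq_of_L2]
    have : Φ z - Φ w = i (z - w).fst + j (z - w).snd := by
      simp only [Φ, WithLp.sub_fst, WithLp.sub_snd, map_sub]
      abel
    have ho : inner ℝ (i (z - w).fst) (j (z - w).snd) = 0 := by
      have hj' : j (z - w).snd ∈ U := hj ▸ ⟨_, rfl⟩
      have hi' : i (z - w).fst ∈ W := hi ▸ ⟨_, rfl⟩
      exact (Submodule.mem_orthogonal _ _).1 (hWU hj') _ hi'
    rw [this, sq, norm_add_sq_eq_norm_sq_add_norm_sq_real ho, i.norm_map, j.norm_map, sq, sq]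
  have hsum : T + R = Φ '' (WithLp.toLp 2 '' {a | t + i a ∈ T} ×ˢ {b | j b ∈ R}) := by
    conv_lhs => rw [← hTi, ← hRj]
    ext y
    constructor
    · rintro ⟨_, ⟨a, ha, rfl⟩, _, ⟨b, hb, rfl⟩, rfl⟩
      exact ⟨_, ⟨(a, b), ⟨ha, hb⟩, rfl⟩, rfl⟩
    · rintro ⟨_, ⟨⟨a, b⟩, ⟨ha, hb⟩, rfl⟩, rfl⟩
      exact ⟨_, ⟨a, ha, rfl⟩, _, ⟨b, hb, rfl⟩, rfl⟩
  rw [hsum, hΦ.hausdorffMeasure_image (Or.inl (by positivity)), h]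
  conv_rhs => rw [← hTi, ← hRj]
  rw [(isometry_const_add_linearIsometry i t).hausdorffMeasure_image (Or.inl (by positivity)),
    j.isometry.hausdorffMeasure_image (Or.inl (by positivity))]

/-! ### Coordinates on convex sets -/

theorem exists_linearIsometry_range_eq_direction {p : ℕ} {C : Set (EuclideanSpace ℝ (Fin p))}
    (hC : Convex ℝ C) {s₀ : EuclideanSpace ℝ (Fin p)} (hs₀ : s₀ ∈ C) :
    ∃ i : EuclideanSpace ℝ (Fin (adim C)) →ₗᵢ[ℝ] EuclideanSpace ℝ (Fin p),
      LinearMap.range i.toLinearMap = Submodule.span ℝ (C - C) ∧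
      (fun a ↦ s₀ + i a) '' ((fun a ↦ s₀ + i a) ⁻¹' C) = C ∧
      Convex ℝ ((fun a ↦ s₀ + i a) ⁻¹' C) ∧ (interior ((fun a ↦ s₀ + i a) ⁻¹' C)).Nonempty := by
  have hdir : vectorSpan ℝ C = Submodule.span ℝ (C - C) := rfl
  obtain ⟨i, hi⟩ := exists_linearIsometry_range_eq (Submodule.span ℝ (C - C))
    (d := adim C) (by rw [adim, direction_affineSpan, hdir])
  have himg : (fun a ↦ s₀ + i a) '' ((fun a ↦ s₀ + i a) ⁻¹' C) = C := by
    refine image_preimage_eq_of_subset fun y hy ↦ ?_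
    obtain ⟨a, ha⟩ : y - s₀ ∈ LinearMap.range i.toLinearMap :=
      hi ▸ Submodule.subset_span (sub_mem_sub hy hs₀)
    refine ⟨a, ?_⟩
    change s₀ + i.toLinearMap a = y
    rw [ha, add_sub_cancel]
  let φ : EuclideanSpace ℝ (Fin (adim C)) →ᵃ[ℝ] EuclideanSpace ℝ (Fin p) :=
    AffineMap.const ℝ _ s₀ + i.toLinearMap.toAffineMap
  have hφ : (fun a ↦ s₀ + i a) = φ := rfl
  have hlin : φ.linear = i.toLinearMap := by simp [φ]
  have hconv : Convex ℝ ((fun a ↦ s₀ + i a) ⁻¹' C) := by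
    rw [hφ]
    exact hC.affine_preimage φ
  refine ⟨i, hi, himg, hconv, ?_⟩
  rw [hconv.interior_nonempty_iff_affineSpan_eq_top,
    AffineSubspace.affineSpan_eq_top_iff_vectorSpan_eq_top_of_nonempty _ _ _
      ⟨0, by simpa using hs₀⟩]
  have h1 := φ.map_vectorSpan (s := (fun a ↦ s₀ + i a) ⁻¹' C)
  rw [← hφ, himg, hdir, hlin, ← hi, LinearMap.range_eq_map] at h1
  exact Submodule.map_injective_of_injective i.injective h1

theorem isAddHaarMeasure_hausdorffMeasure_euclideanSpace (d : ℕ) :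
    (μH[(d : ℝ)] : Measure (EuclideanSpace ℝ (Fin d))).IsAddHaarMeasure := by
  simpa using isAddHaarMeasure_hausdorffMeasure (E := EuclideanSpace ℝ (Fin d))

theorem hausdorffMeasure_adim_pos_lt_top {p : ℕ} {C : Set (EuclideanSpace ℝ (Fin p))}
    (hC : Convex ℝ C) (hCc : IsCompact C) (hCn : C.Nonempty) :
    0 < μH[(adim C : ℝ)] C ∧ μH[(adim C : ℝ)] C < ⊤ := by
  obtain ⟨s₀, hs₀⟩ := hCn
  obtain ⟨i, -, himg, -, hintG⟩ := exists_linearIsometry_range_eq_direction hC hs₀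
  have hiso := isometry_const_add_linearIsometry i s₀
  have hH := isAddHaarMeasure_hausdorffMeasure_euclideanSpace (adim C)
  have heq : μH[(adim C : ℝ)] C = μH[(adim C : ℝ)] ((fun a ↦ s₀ + i a) ⁻¹' C) := by
    have h := hiso.hausdorffMeasure_image (Or.inl (Nat.cast_nonneg (adim C)))
      ((fun a ↦ s₀ + i a) ⁻¹' C)
    rwa [himg] at h
  rw [heq]
  exact ⟨Measure.measure_pos_of_nonempty_interior _ hintG,
    (hiso.isClosedEmbedding.isCompact_preimage hCc).measure_lt_top⟩

/-! ### Kuratowski limits of sequences of sets -/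

section KuratowskiLimit

variable {E : Type*} [NormedAddCommGroup E]

/-- `C` is the Kuratowski limit of the sequence of sets `F`. -/
def KuratowskiLimit (F : ℕ → Set E) (C : Set E) : Prop :=
  (∀ (φ : ℕ → ℕ) (y : ℕ → E) (l : E), StrictMono φ → (∀ k, y k ∈ F (φ k)) →
    Tendsto y atTop (𝓝 l) → l ∈ C) ∧
  ∀ y ∈ C, ∃ u : ℕ → E, (∀ n, u n ∈ F n) ∧ Tendsto u atTop (𝓝 y)

theorem KuratowskiTendsto.kuratowskiLimit {d p : ℕ} {X : Set (EuclideanSpace ℝ (Fin d))}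
    {F : EuclideanSpace ℝ (Fin d) → Set (EuclideanSpace ℝ (Fin p))}
    {xb : EuclideanSpace ℝ (Fin d)} {C : Set (EuclideanSpace ℝ (Fin p))}
    (h : KuratowskiTendsto X F xb C) {x : ℕ → EuclideanSpace ℝ (Fin d)} (hx : ∀ n, x n ∈ X)
    (hlim : Tendsto x atTop (𝓝 xb)) : KuratowskiLimit (fun n ↦ F (x n)) C :=
  ⟨fun φ y l hφ hy hl ↦ h.1 (x ∘ φ) y l (fun _ ↦ hx _) (hlim.comp hφ.tendsto_atTop) hy hl,
    fun y hy ↦ h.2 y hy x hx hlim⟩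

theorem KuratowskiLimit.nonempty {F : ℕ → Set E} {C : Set E} (h : KuratowskiLimit F C)
    (hC : C.Nonempty) (n : ℕ) : (F n).Nonempty :=
  let ⟨u, hu, _⟩ := h.2 _ hC.some_mem
  ⟨u n, hu n⟩

theorem KuratowskiLimit.eventually_inter_subset {F : ℕ → Set E} {C U K : Set E}
    (h : KuratowskiLimit F C) (hK : IsCompact K) (hU : IsOpen U) (hCU : C ⊆ U) :
    ∀ᶠ n in atTop, F n ∩ K ⊆ U := by
  by_contra hn
  obtain ⟨φ, hφ, hφU⟩ := extraction_of_frequently_atTop (not_eventually.1 hn)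
  simp only [not_subset] at hφU
  choose y hy hyU using hφU
  obtain ⟨l, -, ψ, hψ, hl⟩ := hK.tendsto_subseq fun k ↦ (hy k).2
  have hlC : l ∈ C := h.1 (φ ∘ ψ) (y ∘ ψ) l (hφ.comp hψ) (fun k ↦ (hy _).1) hl
  obtain ⟨k, hk⟩ := (hl.eventually (hU.mem_nhds (hCU hlC))).exists
  exact hyU _ hk

theorem KuratowskiLimit.eventually_subset_thickening {F : ℕ → Set E} {C : Set E}
    (h : KuratowskiLimit F C) (hC : IsCompact C) {δ : ℝ} (hδ : 0 < δ) :
    ∀ᶠ n in atTop, C ⊆ Metric.thickening δ (F n) := by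
  obtain ⟨t, htC, htf, hcov⟩ := hC.finite_cover_balls (half_pos hδ)
  have hev : ∀ᶠ n in atTop, ∀ y ∈ t, y ∈ Metric.thickening (δ / 2) (F n) := by
    refine (eventually_all_finite htf).2 fun y hy ↦ ?_
    obtain ⟨u, hu, hlim⟩ := h.2 y (htC hy)
    filter_upwards [Metric.tendsto_nhds.1 hlim _ (half_pos hδ)] with n hn
    exact Metric.mem_thickening_iff.2 ⟨u n, hu n, by rwa [dist_comm]⟩
  filter_upwards [hev] with n hn x hx
  obtain ⟨y, hy, hxy⟩ := mem_iUnion₂.1 (hcov hx)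
  obtain ⟨z, hz, hyz⟩ := Metric.mem_thickening_iff.1 (hn y hy)
  refine Metric.mem_thickening_iff.2 ⟨z, hz, ?_⟩
  linarith [dist_triangle x y z, Metric.mem_ball.1 hxy]

end KuratowskiLimit

section InnerProductSpace

variable {E : Type*} [NormedAddCommGroup E] [InnerProductSpace ℝ E]

theorem eventually_norm_le_two_mul_norm (W : Submodule ℝ E) [FiniteDimensional ℝ W]
    {A : ℕ → E →L[ℝ] E}
    (h : ∀ w ∈ W, Tendsto (fun n ↦ A n w) atTop (𝓝 w)) :
    ∀ᶠ n in atTop, ∀ w ∈ W, ‖w‖ ≤ 2 * ‖A n w‖ := by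
  let b := stdOrthonormalBasis ℝ W
  have hsum : Tendsto (fun n ↦ ∑ j, ‖(b j : E) - A n (b j)‖) atTop (𝓝 0) := by
    rw [← Finset.sum_const_zero (s := (Finset.univ : Finset (Fin (Module.finrank ℝ W))))]
    refine tendsto_finsetSum _ fun j _ ↦ ?_
    simpa using (tendsto_const_nhds (x := (b j : E))).sub (h _ (b j).2) |>.norm
  filter_upwards [hsum.eventually (gt_mem_nhds (show (0 : ℝ) < 1 / 2 by norm_num))] with n hn w hw
  have hrep : w = ∑ j, inner ℝ (b j) (⟨w, hw⟩ : W) • (b j : E) := by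
    have := congrArg Subtype.val (b.sum_repr' (⟨w, hw⟩ : W))
    simpa using this.symm
  have hdiff : ‖w - A n w‖ ≤ ‖w‖ * (1 / 2) := by
    calc ‖w - A n w‖ = ‖∑ j, inner ℝ (b j) (⟨w, hw⟩ : W) • ((b j : E) - A n (b j))‖ := by
          conv_lhs => rw [hrep]
          simp only [map_sum, map_smul, smul_sub, Finset.sum_sub_distrib]
      _ ≤ ∑ j, ‖w‖ * ‖(b j : E) - A n (b j)‖ := by
          refine norm_sum_le_of_le _ fun j _ ↦ ?_
          rw [norm_smul]
          gcongr
          simpa [b.norm_eq_one] using norm_inner_le_norm (𝕜 := ℝ) (b j) (⟨w, hw⟩ : W)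
      _ ≤ ‖w‖ * (1 / 2) := by
          rw [← Finset.mul_sum]
          gcongr
  linarith [norm_sub_norm_le w (A n w)]

theorem tendsto_starProjection_span_sub [FiniteDimensional ℝ E]
    {T : ℕ → Set E} {C : Set E}
    (h : KuratowskiLimit T C)
    {w : E} (hw : w ∈ Submodule.span ℝ (C - C)) :
    Tendsto (fun n ↦ (Submodule.span ℝ (T n - T n)).starProjection w) atTop (𝓝 w) := by
  induction hw using Submodule.span_induction with
  | mem w hw =>
    obtain ⟨a, ha, b, hb, rfl⟩ := hw
    obtain ⟨u, hu, hua⟩ := h.2 a ha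
    obtain ⟨v, hv, hvb⟩ := h.2 b hb
    have hlim : Tendsto (fun n ↦ u n - v n) atTop (𝓝 (a - b)) := hua.sub hvb
    have h0 : Tendsto (fun n ↦ (Submodule.span ℝ (T n - T n)).starProjection
        (a - b - (u n - v n))) atTop (𝓝 0) := by
      refine squeeze_zero_norm (fun n ↦ Submodule.norm_starProjection_apply_le _ _) ?_
      simpa using (tendsto_const_nhds (x := a - b)).sub hlim |>.norm
    have h1 := h0.add hlim
    rw [zero_add] at h1
    refine h1.congr fun n ↦ ?_
    have h2 : (Submodule.span ℝ (T n - T n)).starProjection (u n - v n) = u n - v n :=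
      Submodule.starProjection_eq_self_iff.2 (Submodule.subset_span (sub_mem_sub (hu n) (hv n)))
    rw [map_sub, h2, sub_add_cancel]
  | zero => simp
  | add x y _ _ hx hy => simpa using hx.add hy
  | smul c x _ hx => simpa using hx.const_smul c

end InnerProductSpace

/-! ### Semicontinuity of the Hausdorff measure along Kuratowski limits -/

theorem eventually_hausdorffMeasure_inter_lt {p : ℕ} {C K : Set (EuclideanSpace ℝ (Fin p))}
    {T : ℕ → Set (EuclideanSpace ℝ (Fin p))} (hC : Convex ℝ C) (hCc : IsCompact C)
    (hCn : C.Nonempty) (hT : KuratowskiLimit T C)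
    (hdim : ∀ n, Module.finrank ℝ (Submodule.span ℝ (T n - T n)) = adim C) (hK : IsCompact K)
    {c : ℝ≥0∞} (hc : μH[(adim C : ℝ)] C < c) :
    ∀ᶠ n in atTop, μH[(adim C : ℝ)] (T n ∩ K) < c := by
  obtain ⟨s₀, hs₀⟩ := hCn
  obtain ⟨i, hi, himg, -, -⟩ := exists_linearIsometry_range_eq_direction hC hs₀
  have hH := isAddHaarMeasure_hausdorffMeasure_euclideanSpace (adim C)
  have hiso := isometry_const_add_linearIsometry i s₀
  set C' := (fun a ↦ s₀ + i a) ⁻¹' C with hC'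
  have hCc' : IsCompact C' := hiso.isClosedEmbedding.isCompact_preimage hCc
  have hvol : μH[(adim C : ℝ)] C = μH[(adim C : ℝ)] C' := by
    have h := hiso.hausdorffMeasure_image (Or.inl (Nat.cast_nonneg (adim C))) C'
    rwa [himg] at h
  have hfin : Module.finrank ℝ (Submodule.span ℝ (C - C)) = adim C := by
    rw [← hi, LinearMap.finrank_range_of_inj i.injective, finrank_euclideanSpace_fin]
  have hlim := tendsto_measure_cthickening_of_isCompact
    (μ := (μH[(adim C : ℝ)] : Measure (EuclideanSpace ℝ (Fin (adim C))))) hCc'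
  obtain ⟨ε, hε, hεc⟩ := Metric.eventually_nhds_iff.1
    (hlim.eventually (gt_mem_nhds (hvol ▸ hc)))
  have hδ : 0 < ε / 4 := by positivity
  have hsmall : μH[(adim C : ℝ)] (Metric.cthickening (2 * (ε / 4)) C') < c := by
    refine hεc ?_
    rw [Real.dist_eq, sub_zero, abs_of_pos (by positivity)]
    linarith
  filter_upwards [hT.eventually_inter_subset hK Metric.isOpen_thickening
      (Metric.self_subset_thickening hδ C),
    eventually_norm_le_two_mul_norm (Submodule.span ℝ (C - C))
      fun w hw ↦ tendsto_starProjection_span_sub hT hw] with n hn hnorm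
  obtain ⟨t, ht⟩ := hT.nonempty ⟨s₀, hs₀⟩ n
  set W := Submodule.span ℝ (T n - T n) with hW
  have hsurj : ∀ u ∈ W, ∃ w ∈ Submodule.span ℝ (C - C), W.starProjection w = u := by
    let f : Submodule.span ℝ (C - C) →ₗ[ℝ] W :=
      (W.orthogonalProjectionOnto).toLinearMap ∘ₗ (Submodule.span ℝ (C - C)).subtype
    have hf : Function.Injective f := by
      rw [injective_iff_map_eq_zero]
      intro w hw
      have h0 : W.starProjection (w : EuclideanSpace ℝ (Fin p)) = 0 := congrArg Subtype.val hw
      have := hnorm w w.2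
      rw [h0, norm_zero, mul_zero, norm_le_zero_iff] at this
      exact Subtype.ext this
    have hf' : Function.Surjective f :=
      (LinearMap.injective_iff_surjective_of_finrank_eq_finrank (by rw [hfin, hdim n])).1 hf
    intro u hu
    obtain ⟨w, hw⟩ := hf' ⟨u, hu⟩
    exact ⟨w, w.2, congrArg Subtype.val hw⟩
  let g : EuclideanSpace ℝ (Fin (adim C)) → EuclideanSpace ℝ (Fin p) :=
    fun a ↦ t + W.starProjection (s₀ + i a - t)
  have hg : LipschitzWith 1 g := by
    refine LipschitzWith.of_dist_le_mul fun a b ↦ ?_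
    rw [dist_eq_norm, dist_eq_norm]
    have : g a - g b = W.starProjection (i (a - b)) := by
      simp only [g, map_sub, map_add]
      abel
    rw [this, NNReal.coe_one, one_mul, ← i.norm_map]
    exact Submodule.norm_starProjection_apply_le _ _
  have hsub : T n ∩ K ⊆ g '' Metric.cthickening (2 * (ε / 4)) C' := by
    intro y hy
    obtain ⟨s, hs, hys⟩ := Metric.mem_thickening_iff.1 (hn hy)
    obtain ⟨w, hw, hwy⟩ := hsurj (W.starProjection (y - s)) (Submodule.starProjection_apply_mem _ _)
    obtain ⟨a, ha, rfl⟩ : s ∈ (fun a ↦ s₀ + i a) '' C' := himg.symm.subset hs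
    obtain ⟨b, rfl⟩ : w ∈ LinearMap.range i.toLinearMap := hi ▸ hw
    refine ⟨a + b, ?_, ?_⟩
    · refine Metric.mem_cthickening_of_dist_le _ a _ _ ha ?_
      rw [dist_eq_norm, add_sub_cancel_left, ← i.norm_map]
      refine (hnorm _ hw).trans ?_
      gcongr
      rw [hwy]
      refine (Submodule.norm_starProjection_apply_le _ _).trans ?_
      rw [← dist_eq_norm]
      exact hys.le
    · have hyt : W.starProjection (y - t) = y - t :=
        Submodule.starProjection_eq_self_iff.2 (Submodule.subset_span (sub_mem_sub hy.1 ht))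
      have hwy' : W.starProjection (i b) = W.starProjection (y - (s₀ + i a)) := hwy
      have : s₀ + i (a + b) - t = (s₀ + i a - t) + i b := by
        rw [map_add]
        abel
      simp only [g]
      rw [this, map_add, hwy', ← map_add, sub_add_sub_cancel', hyt, add_sub_cancel]
  calc μH[(adim C : ℝ)] (T n ∩ K) ≤ μH[(adim C : ℝ)] (g '' Metric.cthickening (2 * (ε / 4)) C') :=
        measure_mono hsub
    _ ≤ μH[(adim C : ℝ)] (Metric.cthickening (2 * (ε / 4)) C') := by
        simpa using hg.hausdorffMeasure_image_le (Nat.cast_nonneg (adim C))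
          (Metric.cthickening (2 * (ε / 4)) C')
    _ < c := hsmall

theorem mem_of_closedBall_subset_of_subset_cthickening {F : Type*} [NormedAddCommGroup F]
    [InnerProductSpace ℝ F] [CompleteSpace F] {A B : Set F} (hA : Convex ℝ A) (hAc : IsClosed A)
    {z : F} {δ η : ℝ} (hδ : 0 ≤ δ) (hη : δ < η) (hz : Metric.closedBall z η ⊆ B)
    (hB : ∀ b ∈ B, ∃ a ∈ A, dist b a ≤ δ) : z ∈ A := by
  by_contra hzA
  obtain ⟨f, u, hfA, hfz⟩ := geometric_hahn_banach_closed_point hA hAc hzA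
  set v := (InnerProductSpace.toDual ℝ F).symm f with hv
  have hf : ∀ x, f x = inner ℝ v x := fun x ↦ by simp [hv]
  obtain ⟨a₀, ha₀, -⟩ := hB z (hz (Metric.mem_closedBall_self (hδ.trans hη.le)))
  have hv0 : v ≠ 0 := by
    intro h0
    have h1 := hfA a₀ ha₀
    rw [hf, h0, inner_zero_left] at h1 hfz
    exact lt_asymm h1 hfz
  have hvpos : 0 < ‖v‖ := norm_pos_iff.2 hv0
  obtain ⟨a, ha, hda⟩ := hB (z + (η / ‖v‖) • v) (hz (by
    rw [Metric.mem_closedBall, dist_eq_norm, add_sub_cancel_left, norm_smul, norm_div, norm_norm,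
      div_mul_cancel₀ _ hvpos.ne', Real.norm_of_nonneg (hδ.trans hη.le)]))
  have h1 : inner ℝ v (z + (η / ‖v‖) • v - a) = f z - f a + η * ‖v‖ := by
    rw [inner_sub_right, inner_add_right, inner_smul_right, real_inner_self_eq_norm_sq, hf, hf]
    field_simp
    ring
  have h2 : inner ℝ v (z + (η / ‖v‖) • v - a) ≤ ‖v‖ * δ := by
    refine (real_inner_le_norm _ _).trans ?_
    rw [← dist_eq_norm]
    gcongr
  nlinarith [hfA a ha]

theorem measure_le_liminf_of_eventually_mem {α : Type*} [MeasurableSpace α] (μ : Measure α)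
    {B : Set α} {A : ℕ → Set α} (h : ∀ z ∈ B, ∀ᶠ n in atTop, z ∈ A n) :
    μ B ≤ liminf (fun n ↦ μ (A n)) atTop := by
  have hmono : Monotone fun N ↦ ⋂ n, ⋂ (_ : n ≥ N), A n := fun N M hNM ↦
    iInter_mono fun n ↦ iInter_mono' fun hn ↦ ⟨hNM.trans hn, subset_rfl⟩
  calc μ B ≤ μ (⋃ N, ⋂ n, ⋂ (_ : n ≥ N), A n) := measure_mono fun z hz ↦ by
        simpa only [mem_iUnion, mem_iInter] using eventually_atTop.1 (h z hz)
    _ = ⨆ N, μ (⋂ n, ⋂ (_ : n ≥ N), A n) := hmono.measure_iUnion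
    _ ≤ liminf (fun n ↦ μ (A n)) atTop := by
        rw [liminf_eq_iSup_iInf_of_nat]
        exact iSup_mono fun N ↦ le_iInf₂ fun n hn ↦ measure_mono (iInter₂_subset n hn)

theorem hausdorffMeasure_inter_le_liminf {p : ℕ} {C K G : Set (EuclideanSpace ℝ (Fin p))}
    {T R : ℕ → Set (EuclideanSpace ℝ (Fin p))} (hC : Convex ℝ C) (hCc : IsCompact C)
    (hCn : C.Nonempty) (hT : KuratowskiLimit T C) (hK : IsCompact K) (hTK : ∀ n, T n ⊆ K)
    (hR : ∀ ε > 0, ∀ᶠ n in atTop, R n ⊆ Metric.ball 0 ε) (hG : IsOpen G) :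
    μH[(adim C : ℝ)] (C ∩ G) ≤ liminf (fun n ↦ μH[(adim C : ℝ)]
      {c | c ∈ closure (convexHull ℝ (T n)) ∧ ∀ r ∈ R n, c + r ∈ G}) atTop := by
  obtain ⟨s₀, hs₀⟩ := hCn
  obtain ⟨i, hi, himg, hconv, -⟩ := exists_linearIsometry_range_eq_direction hC hs₀
  have hH := isAddHaarMeasure_hausdorffMeasure_euclideanSpace (adim C)
  have hiso := isometry_const_add_linearIsometry i s₀
  set C' := (fun a ↦ s₀ + i a) ⁻¹' C with hC'
  set G' := (fun a ↦ s₀ + i a) ⁻¹' G with hG'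
  have hCc' : IsCompact C' := hiso.isClosedEmbedding.isCompact_preimage hCc
  let P : EuclideanSpace ℝ (Fin p) → EuclideanSpace ℝ (Fin (adim C)) :=
    fun y ↦ i.toContinuousLinearMap.adjoint (y - s₀)
  have hP : LipschitzWith 1 P := by
    refine LipschitzWith.of_dist_le_mul fun a b ↦ ?_
    rw [dist_eq_norm, dist_eq_norm, NNReal.coe_one]
    have : P a - P b = i.toContinuousLinearMap.adjoint (a - b) := by
      simp only [P, ← map_sub, sub_sub_sub_cancel_right]
    rw [this]
    refine ContinuousLinearMap.le_of_opNorm_le _ ?_ _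
    rw [LinearIsometryEquiv.norm_map]
    exact i.norm_toContinuousLinearMap_le
  have hPd : ∀ a b, dist (P a) (P b) ≤ dist a b := fun a b ↦ by simpa using hP.dist_le_mul a b
  have hPi : ∀ a, P (s₀ + i a) = a := by
    intro a
    have h := (ContinuousLinearMap.norm_map_iff_adjoint_comp_self i.toContinuousLinearMap).1
      i.norm_map
    simp only [P, add_sub_cancel_left]
    exact DFunLike.congr_fun h a
  have hPaff : ∀ A, Convex ℝ A → Convex ℝ (P '' A) := by
    intro A hA
    have h := (hA.translate (-s₀)).linear_image i.toContinuousLinearMap.adjoint.toLinearMap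
    rw [image_image] at h
    have hPeq : P = fun y ↦ i.toContinuousLinearMap.adjoint (-s₀ + y) :=
      funext fun y ↦ by simp only [P, sub_eq_neg_add]
    rw [hPeq]
    exact h
  have hvol : μH[(adim C : ℝ)] (C ∩ G) = μH[(adim C : ℝ)] (C' ∩ G') := by
    have h := hiso.hausdorffMeasure_image (Or.inl (Nat.cast_nonneg (adim C))) (C' ∩ G')
    rw [image_inter_preimage, himg] at h
    exact h
  have hintG : μH[(adim C : ℝ)] (C' ∩ G') ≤ μH[(adim C : ℝ)] (interior C' ∩ G') := by
    calc μH[(adim C : ℝ)] (C' ∩ G')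
        ≤ μH[(adim C : ℝ)] (interior C' ∩ G' ∪ frontier C') := measure_mono fun z hz ↦ by
          by_cases h : z ∈ interior C'
          · exact Or.inl ⟨h, hz.2⟩
          · exact Or.inr ⟨subset_closure hz.1, h⟩
      _ ≤ μH[(adim C : ℝ)] (interior C' ∩ G') + μH[(adim C : ℝ)] (frontier C') :=
          measure_union_le _ _
      _ = μH[(adim C : ℝ)] (interior C' ∩ G') := by
          rw [hconv.addHaar_frontier μH[(adim C : ℝ)], add_zero]
  rw [hvol]
  refine hintG.trans ((measure_le_liminf_of_eventually_mem _
    (A := fun n ↦ P '' {c | c ∈ closure (convexHull ℝ (T n)) ∧ ∀ r ∈ R n, c + r ∈ G})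
    fun z hz ↦ ?_).trans (liminf_le_liminf (Eventually.of_forall fun n ↦ ?_)))
  · obtain ⟨η, hη, hηC⟩ := Metric.nhds_basis_closedBall.mem_iff.1 (mem_interior_iff_mem_nhds.1 hz.1)
    obtain ⟨ε, hε, hεG⟩ := Metric.isOpen_iff.1 hG _ hz.2
    obtain ⟨δ, hδ, hδη, hδε⟩ : ∃ δ > 0, δ < η ∧ 5 * δ < ε :=
      ⟨min (η / 2) (ε / 8), by positivity, (min_le_left _ _).trans_lt (half_lt_self hη), by
        linarith [min_le_right (η / 2) (ε / 8)]⟩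
    filter_upwards [hT.eventually_subset_thickening hCc hδ,
      hT.eventually_inter_subset hK Metric.isOpen_thickening (Metric.self_subset_thickening hδ C),
      hR δ hδ] with n hn hnT hnR
    have hTn : T n ⊆ Metric.thickening δ C := fun y hy ↦ hnT ⟨hy, hTK n hy⟩
    have hcl : closure (convexHull ℝ (T n)) ⊆ Metric.thickening (2 * δ) C := by
      refine (closure_mono (convexHull_min hTn (hC.thickening δ))).trans ?_
      refine (Metric.closure_thickening_subset_cthickening δ C).trans ?_
      exact Metric.cthickening_subset_thickening' (by positivity) (by linarith) C
    have hcomp : IsCompact (closure (convexHull ℝ (T n))) :=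
      (isBounded_convexHull.2 (hK.isBounded.subset (hTK n))).isCompact_closure
    obtain ⟨c, hc, hcz⟩ : z ∈ P '' closure (convexHull ℝ (T n)) := by
      refine mem_of_closedBall_subset_of_subset_cthickening
        (hPaff _ (convex_convexHull ℝ _).closure)
        (hcomp.image hP.continuous).isClosed hδ.le hδη hηC fun b hb ↦ ?_
      obtain ⟨y, hy, hby⟩ := Metric.mem_thickening_iff.1 (hn hb)
      refine ⟨P y, mem_image_of_mem P (subset_closure (subset_convexHull ℝ _ hy)), ?_⟩
      have := hPd (s₀ + i b) y
      rw [hPi] at this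
      exact this.trans hby.le
    refine ⟨c, ⟨hc, fun r hr ↦ hεG ?_⟩, hcz⟩
    obtain ⟨s, hs, hcs⟩ := Metric.mem_thickening_iff.1 (hcl hc)
    obtain ⟨a, ha, rfl⟩ : s ∈ (fun a ↦ s₀ + i a) '' C' := himg.symm.subset hs
    have h1 : dist z a ≤ dist c (s₀ + i a) := by
      have := hPd c (s₀ + i a)
      rwa [hPi, hcz] at this
    have h2 : dist (s₀ + i a) (s₀ + i z) = dist z a := by
      rw [dist_comm z a]
      exact hiso.dist_eq a z
    have h3 : dist (c + r) c < δ := by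
      rw [dist_eq_norm, add_sub_cancel_left]
      exact mem_ball_zero_iff.1 (hnR hr)
    have h4 : dist c (s₀ + i a) < 2 * δ := hcs
    rw [Metric.mem_ball]
    linarith [dist_triangle (c + r) c (s₀ + i z), dist_triangle c (s₀ + i a) (s₀ + i z)]
  · simpa using hP.hausdorffMeasure_image_le (Nat.cast_nonneg (adim C))
      {c | c ∈ closure (convexHull ℝ (T n)) ∧ ∀ r ∈ R n, c + r ∈ G}

theorem eventually_span_sub_le {E : Type*} [NormedAddCommGroup E] [InnerProductSpace ℝ E]
    [FiniteDimensional ℝ E] {C : Set E} {S T₀ T₁ R₁ : ℕ → Set E}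
    (hS₁ : ∀ n, S n ⊆ T₁ n + R₁ n)
    (hR₁ : ∀ n, ∀ r ∈ R₁ n, r ∈ (Submodule.span ℝ (T₁ n - T₁ n))ᗮ ⊓ Submodule.span ℝ (S n - S n))
    (hW₀ : ∀ n, Submodule.span ℝ (T₀ n - T₀ n) ≤ Submodule.span ℝ (S n - S n))
    (hd₁ : ∀ n, Module.finrank ℝ (Submodule.span ℝ (T₁ n - T₁ n)) =
      Module.finrank ℝ (Submodule.span ℝ (C - C)))
    (hT₀l : KuratowskiLimit T₀ C) (hT₁l : KuratowskiLimit T₁ C) :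
    ∀ᶠ n in atTop, Submodule.span ℝ (T₁ n - T₁ n) ≤ Submodule.span ℝ (S n - S n) := by
  have hcomp : ∀ x ∈ Submodule.span ℝ (C - C), Tendsto (fun n ↦
      ((Submodule.span ℝ (T₁ n - T₁ n)).starProjection ∘L
        (Submodule.span ℝ (T₀ n - T₀ n)).starProjection) x) atTop (𝓝 x) := fun x hx ↦ by
    have h0 := tendsto_starProjection_span_sub hT₀l hx
    have h1 := tendsto_starProjection_span_sub hT₁l hx
    have h2 : Tendsto (fun n ↦ (Submodule.span ℝ (T₁ n - T₁ n)).starProjection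
        ((Submodule.span ℝ (T₀ n - T₀ n)).starProjection x - x)) atTop (𝓝 0) := by
      refine squeeze_zero_norm (fun n ↦ Submodule.norm_starProjection_apply_le _ _) ?_
      simpa using (h0.sub (tendsto_const_nhds (x := x))).norm
    have h3 := h2.add h1
    rw [zero_add] at h3
    refine h3.congr fun n ↦ ?_
    rw [map_sub, sub_add_cancel]
    rfl
  filter_upwards [eventually_norm_le_two_mul_norm _ hcomp] with n hn
  set W₀ := Submodule.span ℝ (T₀ n - T₀ n)
  set W₁ := Submodule.span ℝ (T₁ n - T₁ n) with hW₁
  set V := Submodule.span ℝ (S n - S n) with hV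
  have hproj : ∀ x ∈ V, W₁.starProjection x ∈ V := fun x hx ↦ by
    induction hx using Submodule.span_induction with
    | mem x hx =>
      obtain ⟨a, ha, b, hb, rfl⟩ := hx
      obtain ⟨t, ht, r, hr, rfl⟩ := hS₁ n ha
      obtain ⟨t', ht', r', hr', rfl⟩ := hS₁ n hb
      have h1 : W₁.starProjection (t + r - (t' + r')) = t - t' := by
        have hr0 : W₁.starProjection (r - r') = 0 :=
          (Submodule.starProjection_apply_eq_zero_iff _).2
            (W₁ᗮ.sub_mem (hR₁ n r hr).1 (hR₁ n r' hr').1)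
        have ht0 : W₁.starProjection (t - t') = t - t' :=
          Submodule.starProjection_eq_self_iff.2 (Submodule.subset_span (sub_mem_sub ht ht'))
        rw [add_sub_add_comm, map_add, hr0, ht0, add_zero]
      have h2 : t - t' = (t + r - (t' + r')) - (r - r') := by abel
      change W₁.starProjection (t + r - (t' + r')) ∈ V
      rw [h1, h2]
      exact V.sub_mem (Submodule.subset_span (sub_mem_sub ha hb))
        (V.sub_mem (hR₁ n r hr).2 (hR₁ n r' hr').2)
    | zero => simp
    | add x y _ _ hx hy => simpa using V.add_mem hx hy
    | smul c x _ hx => simpa using V.smul_mem c hx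
  let f : Submodule.span ℝ (C - C) →ₗ[ℝ] (W₁ ⊓ V : Submodule ℝ (E)) :=
    LinearMap.codRestrict _ ((W₁.starProjection ∘L W₀.starProjection).toLinearMap ∘ₗ
      (Submodule.span ℝ (C - C)).subtype) fun x ↦ ⟨Submodule.starProjection_apply_mem _ _,
        hproj _ (hW₀ n (Submodule.starProjection_apply_mem _ _))⟩
  have hf : Function.Injective f := by
    rw [injective_iff_map_eq_zero]
    intro x hx
    have h0 : (W₁.starProjection ∘L W₀.starProjection) (x : E) = 0 :=
      congrArg Subtype.val hx
    have := hn x x.2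
    rw [h0, norm_zero, mul_zero, norm_le_zero_iff] at this
    exact Subtype.ext this
  have hle := LinearMap.finrank_le_finrank_of_injective hf
  have heq : W₁ ⊓ V = W₁ := Submodule.eq_of_le_of_finrank_le inf_le_left (by
    rwa [hW₁, hd₁ n])
  exact inf_eq_left.1 heq

/-! ### Weak convergence of the normalised Hausdorff measures -/

theorem hausdorffMeasure_inter_div_le_liminf {p : ℕ} {C Y G : Set (EuclideanSpace ℝ (Fin p))}
    {S T₀ T₁ R₀ R₁ : ℕ → Set (EuclideanSpace ℝ (Fin p))} (hC : Convex ℝ C) (hCc : IsCompact C)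
    (hCn : C.Nonempty) (hY : IsCompact Y) (hSY : ∀ n, S n ⊆ Y) (hSconv : ∀ n, Convex ℝ (S n))
    (hSc : ∀ n, IsCompact (S n)) (hS₀ : ∀ n, T₀ n + R₀ n ⊆ S n) (hS₁ : ∀ n, S n ⊆ T₁ n + R₁ n)
    (hR₀ : ∀ n, ∀ r ∈ R₀ n, r ∈ (Submodule.span ℝ (T₀ n - T₀ n))ᗮ ⊓ Submodule.span ℝ (S n - S n))
    (hR₁ : ∀ n, ∀ r ∈ R₁ n, r ∈ (Submodule.span ℝ (T₁ n - T₁ n))ᗮ ⊓ Submodule.span ℝ (S n - S n))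
    (hd₀ : ∀ n, adim (T₀ n) = adim C) (hd₁ : ∀ n, adim (T₁ n) = adim C)
    (hR₀l : KuratowskiLimit R₀ {0}) (hT₀l : KuratowskiLimit T₀ C) (hT₁l : KuratowskiLimit T₁ C)
    (hratio : Tendsto (fun n ↦ (μH[((adim (S n) - adim C : ℕ) : ℝ)] (R₀ n)).toReal /
      (μH[((adim (S n) - adim C : ℕ) : ℝ)] (R₁ n)).toReal) atTop (𝓝 1)) (hG : IsOpen G) :
    μH[(adim C : ℝ)] (C ∩ G) / μH[(adim C : ℝ)] C ≤
      liminf (fun n ↦ μH[(adim (S n) : ℝ)] (S n ∩ G) / μH[(adim (S n) : ℝ)] (S n)) atTop := by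
  have hdir : ∀ A : Set (EuclideanSpace ℝ (Fin p)),
      Module.finrank ℝ (Submodule.span ℝ (A - A)) = adim A := fun A ↦ by
    rw [adim, direction_affineSpan]
    rfl
  choose κ hκ0 hκt hκ using exists_hausdorffMeasure_add (adim C)
  obtain ⟨M, hM⟩ := hY.isBounded.exists_norm_le
  -- uniform bounds
  obtain ⟨s₀, hs₀⟩ := hCn
  obtain ⟨u, hu, hul⟩ := hT₀l.2 s₀ hs₀
  obtain ⟨v, hv, hvl⟩ := hR₀l.2 0 rfl
  obtain ⟨w, hw, hwl⟩ := hT₁l.2 s₀ hs₀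
  obtain ⟨Mu, hMu⟩ := hul.norm.bddAbove_range
  obtain ⟨Mv, hMv⟩ := hvl.norm.bddAbove_range
  obtain ⟨Mw, hMw⟩ := hwl.norm.bddAbove_range
  have hMu' : ∀ n, ‖u n‖ ≤ Mu := fun n ↦ hMu ⟨n, rfl⟩
  have hMv' : ∀ n, ‖v n‖ ≤ Mv := fun n ↦ hMv ⟨n, rfl⟩
  have hMw' : ∀ n, ‖w n‖ ≤ Mw := fun n ↦ hMw ⟨n, rfl⟩
  have hT₀K : ∀ n, T₀ n ⊆ Metric.closedBall 0 (M + Mv) := fun n t ht ↦ by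
    rw [mem_closedBall_zero_iff]
    have h1 := hM _ (hSY n (hS₀ n (add_mem_add ht (hv n))))
    have h2 := norm_sub_le (t + v n) (v n)
    rw [add_sub_cancel_right] at h2
    linarith [hMv' n]
  have hR₀K : ∀ n, R₀ n ⊆ Metric.closedBall 0 (M + Mu) := fun n r hr ↦ by
    rw [mem_closedBall_zero_iff]
    have h1 := hM _ (hSY n (hS₀ n (add_mem_add (hu n) hr)))
    have h2 := norm_sub_le (u n + r) (u n)
    rw [add_sub_cancel_left] at h2
    linarith [hMu' n]
  have hR₀s : ∀ ε > 0, ∀ᶠ n in atTop, R₀ n ⊆ Metric.ball 0 ε := fun ε hε ↦ by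
    filter_upwards [hR₀l.eventually_inter_subset (isCompact_closedBall 0 (M + Mu))
      Metric.isOpen_ball (singleton_subset_iff.2 (Metric.mem_ball_self hε))] with n hn r hr
    exact hn ⟨hr, hR₀K n hr⟩
  set K := Metric.closedBall (0 : EuclideanSpace ℝ (Fin p)) (M + 2 * Mw)
  have hS₁K : ∀ n, S n ⊆ (T₁ n ∩ K) + R₁ n := fun n s hs ↦ by
    obtain ⟨t, ht, r, hr, rfl⟩ := hS₁ n hs
    refine ⟨t, ⟨ht, ?_⟩, r, hr, rfl⟩
    have horth : inner ℝ (t - w n) r = 0 := (Submodule.mem_orthogonal _ _).1 (hR₁ n r hr).1 _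
      (Submodule.subset_span (sub_mem_sub ht (hw n)))
    have h1 : ‖t - w n‖ ≤ ‖t + r - w n‖ := by
      have h2 : t + r - w n = (t - w n) + r := by abel
      rw [h2, ← abs_norm, ← abs_norm (t - w n + r), ← sq_le_sq, sq, sq,
        norm_add_sq_eq_norm_sq_add_norm_sq_real horth]
      nlinarith [norm_nonneg r]
    rw [mem_closedBall_zero_iff]
    have h3 := norm_sub_le (t + r) (w n)
    have h4 := norm_add_le (t - w n) (w n)
    rw [sub_add_cancel] at h4
    linarith [hM _ (hSY n hs), hMw' n]
  -- dimensions
  have hW₀ : ∀ n, Submodule.span ℝ (T₀ n - T₀ n) ≤ Submodule.span ℝ (S n - S n) := fun n ↦ by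
    refine Submodule.span_mono ?_
    rintro _ ⟨a, ha, b, hb, rfl⟩
    refine ⟨a + v n, hS₀ n (add_mem_add ha (hv n)), b + v n, hS₀ n (add_mem_add hb (hv n)), ?_⟩
    exact add_sub_add_right_eq_sub a b (v n)
  have hdle : ∀ n, adim C ≤ adim (S n) := fun n ↦ by
    rw [← hd₀ n, ← hdir, ← hdir]
    exact Submodule.finrank_mono (hW₀ n)
  have hdadd : ∀ n, adim C + (adim (S n) - adim C) = adim (S n) := fun n ↦
    Nat.add_sub_cancel' (hdle n)
  have hfin : ∀ n (A : Set (EuclideanSpace ℝ (Fin p))), adim A = adim C →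
      Submodule.span ℝ (A - A) ≤ Submodule.span ℝ (S n - S n) →
      Module.finrank ℝ ((Submodule.span ℝ (A - A))ᗮ ⊓ Submodule.span ℝ (S n - S n) :
        Submodule ℝ (EuclideanSpace ℝ (Fin p))) = adim (S n) - adim C := fun n A hA hAS ↦ by
    have := Submodule.finrank_add_inf_finrank_orthogonal hAS
    rw [hdir, hdir, hA] at this
    omega
  have hW₁ : ∀ᶠ n in atTop, Submodule.span ℝ (T₁ n - T₁ n) ≤ Submodule.span ℝ (S n - S n) :=
    eventually_span_sub_le hS₁ hR₁ hW₀ (fun n ↦ by rw [hdir, hdir, hd₁ n]) hT₀l hT₁l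
  -- lower and upper bounds
  set D : ℕ → Set (EuclideanSpace ℝ (Fin p)) :=
    fun n ↦ {c | c ∈ closure (convexHull ℝ (T₀ n)) ∧ ∀ r ∈ R₀ n, c + r ∈ G}
  have hDS : ∀ n, D n + R₀ n ⊆ S n ∩ G := by
    rintro n _ ⟨c, ⟨hc, hcG⟩, r, hr, rfl⟩
    refine ⟨?_, hcG r hr⟩
    have hsub : closure (convexHull ℝ (T₀ n)) ⊆ (fun c ↦ c + r) ⁻¹' S n := by
      refine closure_minimal (convexHull_min (fun t ht ↦ hS₀ n (add_mem_add ht hr)) ?_)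
        ((hSc n).isClosed.preimage (by fun_prop))
      exact (hSconv n).translate_preimage_left r
    exact hsub hc
  have hDW : ∀ n, ∀ c ∈ D n, c - u n ∈ Submodule.span ℝ (T₀ n - T₀ n) := by
    intro n c hc
    have hsub : closure (convexHull ℝ (T₀ n)) ⊆
        (fun c ↦ c + -u n) ⁻¹' (Submodule.span ℝ (T₀ n - T₀ n) : Set _) := by
      refine closure_minimal (convexHull_min (fun t ht ↦ ?_) ?_)
        ((Submodule.closed_of_finiteDimensional _).preimage (by fun_prop))
      · rw [mem_preimage, ← sub_eq_add_neg]
        exact Submodule.subset_span (sub_mem_sub ht (hu n))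
      · exact (Submodule.convex _).translate_preimage_left _
    rw [sub_eq_add_neg c (u n)]
    exact hsub hc.1
  have hlow : ∀ n, κ (adim (S n) - adim C) * (μH[(adim C : ℝ)] (D n) *
      μH[((adim (S n) - adim C : ℕ) : ℝ)] (R₀ n)) ≤ μH[(adim (S n) : ℝ)] (S n ∩ G) := fun n ↦ by
    rw [← hκ _ _ _ (u n) (D n) (R₀ n) ((hdir _).trans (hd₀ n)) (hfin n _ (hd₀ n) (hW₀ n))
      inf_le_left (hDW n) (hR₀ n), hdadd n]
    exact measure_mono (hDS n)
  have hup : ∀ᶠ n in atTop, μH[(adim (S n) : ℝ)] (S n) ≤ κ (adim (S n) - adim C) *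
      (μH[(adim C : ℝ)] (T₁ n ∩ K) * μH[((adim (S n) - adim C : ℕ) : ℝ)] (R₁ n)) := by
    filter_upwards [hW₁] with n hn
    rw [← hκ _ _ _ (w n) (T₁ n ∩ K) (R₁ n) ((hdir _).trans (hd₁ n)) (hfin n _ (hd₁ n) hn)
      inf_le_left (fun y hy ↦ Submodule.subset_span (sub_mem_sub hy.1 (hw n))) (hR₁ n), hdadd n]
    exact measure_mono (hS₁K n)
  have hpos := hausdorffMeasure_adim_pos_lt_top hC hCc ⟨s₀, hs₀⟩
  have ha : Tendsto (fun n ↦ min (μH[(adim C : ℝ)] (D n)) (μH[(adim C : ℝ)] (C ∩ G))) atTop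
      (𝓝 (μH[(adim C : ℝ)] (C ∩ G))) := by
    refine tendsto_order.2 ⟨fun c hc ↦ ?_, fun c hc ↦
      Eventually.of_forall fun n ↦ (min_le_right _ _).trans_lt hc⟩
    filter_upwards [eventually_lt_of_lt_liminf (hc.trans_le (hausdorffMeasure_inter_le_liminf hC
      hCc ⟨s₀, hs₀⟩ hT₀l (isCompact_closedBall 0 (M + Mv)) hT₀K hR₀s hG))] with n hn
    exact lt_min hn hc
  have hb : Tendsto (fun n ↦ max (μH[(adim C : ℝ)] (T₁ n ∩ K)) (μH[(adim C : ℝ)] C)) atTop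
      (𝓝 (μH[(adim C : ℝ)] C)) := by
    refine tendsto_order.2 ⟨fun c hc ↦
      Eventually.of_forall fun n ↦ hc.trans_le (le_max_right _ _), fun c hc ↦ ?_⟩
    filter_upwards [eventually_hausdorffMeasure_inter_lt hC hCc ⟨s₀, hs₀⟩ hT₁l
      (fun n ↦ (hdir _).trans (hd₁ n)) (isCompact_closedBall 0 (M + 2 * Mw)) hc] with n hn
    exact max_lt hn hc
  have hq := ENNReal.tendsto_ofReal hratio
  rw [ENNReal.ofReal_one] at hq
  have hlim := ENNReal.Tendsto.mul (ENNReal.Tendsto.div ha (Or.inr hpos.1.ne') hb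
    (Or.inl hpos.2.ne)) (Or.inr ENNReal.one_ne_top)
    hq (Or.inl one_ne_zero)
  rw [mul_one] at hlim
  rw [← hlim.liminf_eq]
  refine liminf_le_liminf ?_
  filter_upwards [hup, hratio.eventually (lt_mem_nhds (show (0 : ℝ) < 1 by norm_num))]
    with n hn hr
  set ρ₀ := μH[((adim (S n) - adim C : ℕ) : ℝ)] (R₀ n)
  set ρ₁ := μH[((adim (S n) - adim C : ℕ) : ℝ)] (R₁ n)
  have hρ₁ : 0 < ρ₁.toReal := by
    refine ENNReal.toReal_nonneg.lt_of_ne fun h ↦ ?_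
    rw [← h, div_zero] at hr
    exact hr.false
  have hρ₀ : 0 < ρ₀.toReal := (div_pos_iff_of_pos_right hρ₁).1 hr
  rw [ENNReal.toReal_pos_iff] at hρ₁ hρ₀
  rw [← ENNReal.toReal_div, ENNReal.ofReal_toReal (ENNReal.div_ne_top hρ₀.2.ne hρ₁.1.ne')]
  calc min (μH[(adim C : ℝ)] (D n)) (μH[(adim C : ℝ)] (C ∩ G)) /
        max (μH[(adim C : ℝ)] (T₁ n ∩ K)) (μH[(adim C : ℝ)] C) * (ρ₀ / ρ₁)
      ≤ μH[(adim C : ℝ)] (D n) / μH[(adim C : ℝ)] (T₁ n ∩ K) * (ρ₀ / ρ₁) := by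
        gcongr
        · exact min_le_left _ _
        · exact le_max_left _ _
    _ = (μH[(adim C : ℝ)] (D n) * ρ₀) / (μH[(adim C : ℝ)] (T₁ n ∩ K) * ρ₁) := by
        rw [ENNReal.mul_div_mul_comm (Or.inr hρ₁.2.ne) (Or.inr hρ₁.1.ne')]
    _ = (κ (adim (S n) - adim C) * (μH[(adim C : ℝ)] (D n) * ρ₀)) /
        (κ (adim (S n) - adim C) * (μH[(adim C : ℝ)] (T₁ n ∩ K) * ρ₁)) :=
        (ENNReal.mul_div_mul_left _ _ (hκ0 _) (hκt _)).symm
    _ ≤ μH[(adim (S n) : ℝ)] (S n ∩ G) / μH[(adim (S n) : ℝ)] (S n) := by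
        gcongr
        exact hlow n

theorem tendsto_integral_cond_hausdorffMeasure {d p : ℕ} {X : Set (EuclideanSpace ℝ (Fin d))}
    {Y : Set (EuclideanSpace ℝ (Fin p))} (hY : IsCompact Y)
    {S : EuclideanSpace ℝ (Fin d) → Set (EuclideanSpace ℝ (Fin p))}
    (hSY : ∀ x ∈ X, S x ⊆ Y) (hSn : ∀ x ∈ X, (S x).Nonempty) (hSconv : ∀ x ∈ X, Convex ℝ (S x))
    (hSc : ∀ x ∈ X, IsCompact (S x)) {xb : EuclideanSpace ℝ (Fin d)} (hxb : xb ∈ X)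
    (hrect : RectangularlyContinuousAt X S xb) {x : ℕ → EuclideanSpace ℝ (Fin d)}
    (hx : ∀ n, x n ∈ X) (hlim : Tendsto x atTop (𝓝 xb))
    (f : BoundedContinuousFunction (EuclideanSpace ℝ (Fin p)) ℝ) :
    Tendsto (fun n ↦ ∫ y, f y ∂ProbabilityTheory.cond μH[(adim (S (x n)) : ℝ)] (S (x n))) atTop
      (𝓝 (∫ y, f y ∂ProbabilityTheory.cond μH[(adim (S xb) : ℝ)] (S xb))) := by
  obtain ⟨T₀, T₁, R₀, R₁, hsub, hR, hR₀l, -, hT₀l, hT₁l, -, hratio⟩ := hrect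
  have hprob : ∀ z ∈ X, IsProbabilityMeasure
      (ProbabilityTheory.cond μH[(adim (S z) : ℝ)] (S z)) := fun z hz ↦
    have h := hausdorffMeasure_adim_pos_lt_top (hSconv z hz) (hSc z hz) (hSn z hz)
    ProbabilityTheory.cond_isProbabilityMeasure_of_finite h.1.ne' h.2.ne
  have hlimX : Tendsto x atTop (𝓝[X] xb) :=
    tendsto_nhdsWithin_iff.2 ⟨hlim, Eventually.of_forall hx⟩
  obtain ⟨N, hN⟩ := eventually_atTop.1 (hlimX.eventually hsub)
  refine (tendsto_add_atTop_iff_nat N).1 ?_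
  have hxN : ∀ n, x (n + N) ∈ X := fun n ↦ hx _
  have hlimN : Tendsto (fun n ↦ x (n + N)) atTop (𝓝 xb) := (tendsto_add_atTop_iff_nat N).2 hlim
  have hsubN : ∀ n, _ := fun n ↦ hN (n + N) (Nat.le_add_left _ _)
  let ν (z : X) : ProbabilityMeasure (EuclideanSpace ℝ (Fin p)) := ⟨_, hprob z z.2⟩
  have hweak : Tendsto (fun n ↦ ν ⟨_, hxN n⟩) atTop (𝓝 (ν ⟨xb, hxb⟩)) := by
    refine tendsto_of_forall_isOpen_le_liminf' fun G hG ↦ ?_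
    have h := hausdorffMeasure_inter_div_le_liminf (S := fun n ↦ S (x (n + N)))
      (T₀ := fun n ↦ T₀ (x (n + N))) (T₁ := fun n ↦ T₁ (x (n + N)))
      (R₀ := fun n ↦ R₀ (x (n + N))) (R₁ := fun n ↦ R₁ (x (n + N)))
      (hSconv xb hxb) (hSc xb hxb) (hSn xb hxb) hY
      (fun n ↦ hSY _ (hxN n)) (fun n ↦ hSconv _ (hxN n)) (fun n ↦ hSc _ (hxN n))
      (fun n ↦ (hsubN n).1) (fun n ↦ (hsubN n).2) (fun n ↦ (hR _ (hxN n)).1)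
      (fun n ↦ (hR _ (hxN n)).2.1) (fun n ↦ (hR _ (hxN n)).2.2.1)
      (fun n ↦ (hR _ (hxN n)).2.2.2) (hR₀l.kuratowskiLimit hxN hlimN)
      (hT₀l.kuratowskiLimit hxN hlimN) (hT₁l.kuratowskiLimit hxN hlimN)
      (hratio.comp ((tendsto_add_atTop_iff_nat N).2 hlimX)) hG
    simpa only [ν, ProbabilityMeasure.coe_mk, ProbabilityTheory.cond_apply' hG.measurableSet,
      ENNReal.div_eq_inv_mul] using h
  exact ProbabilityMeasure.tendsto_iff_forall_integral_tendsto.1 hweak f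

theorem tendsto_integral_of_continuous_uncurry {α E : Type*} [TopologicalSpace α]
    [TopologicalSpace E] [MeasurableSpace E] [OpensMeasurableSpace E]
    [SecondCountableTopology E] {ν : ℕ → Measure E} {μ : Measure E}
    [∀ n, IsProbabilityMeasure (ν n)] [IsProbabilityMeasure μ]
    {Y : Set E} (hY : IsCompact Y) (hν : ∀ n, ∀ᵐ y ∂ν n, y ∈ Y) (hμ : ∀ᵐ y ∂μ, y ∈ Y)
    (h : ∀ f : BoundedContinuousFunction E ℝ,
      Tendsto (fun n ↦ ∫ y, f y ∂ν n) atTop (𝓝 (∫ y, f y ∂μ)))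
    {g : α → E → ℝ} (hg : Continuous g.uncurry) {x : ℕ → α} {a : α}
    (hx : Tendsto x atTop (𝓝 a)) :
    Tendsto (fun n ↦ ∫ y, g (x n) y ∂ν n) atTop (𝓝 (∫ y, g a y ∂μ)) := by
  have hgc : ∀ z, Continuous (g z) := fun z ↦ hg.comp (Continuous.prodMk_right z)
  have hintG : ∀ z n, Integrable (g z) (ν n) := fun z n ↦ by
    obtain ⟨B, hB⟩ := hY.exists_bound_of_continuousOn (hgc z).continuousOn
    exact Integrable.of_bound (hgc z).aestronglyMeasurable B ((hν n).mono hB)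
  obtain ⟨B, hB⟩ := hY.exists_bound_of_continuousOn (hgc a).continuousOn
  let f : BoundedContinuousFunction E ℝ := BoundedContinuousFunction.ofNormedAddCommGroup
    (fun y ↦ max (-|B|) (min |B| (g a y))) (by fun_prop) |B| fun y ↦
      abs_le.2 ⟨le_max_left _ _, max_le (by linarith [abs_nonneg B]) (min_le_left _ _)⟩
  have hf : ∀ y ∈ Y, f y = g a y := fun y hy ↦ by
    have h1 := abs_le.1 ((hB y hy).trans (le_abs_self B))
    change max (-|B|) (min |B| (g a y)) = g a y
    rw [min_eq_right h1.2, max_eq_right h1.1]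
  have h0 : Tendsto (fun n ↦ ∫ y, g a y ∂ν n) atTop (𝓝 (∫ y, g a y ∂μ)) := by
    rw [← integral_congr_ae (hμ.mono hf)]
    exact (h f).congr fun n ↦ integral_congr_ae ((hν n).mono hf)
  have h1 : Tendsto (fun n ↦ ∫ y, g (x n) y ∂ν n - ∫ y, g a y ∂ν n) atTop (𝓝 0) := by
    refine Metric.tendsto_nhds.2 fun ε hε ↦ ?_
    obtain ⟨v, hv, hvY⟩ := hY.mem_uniformity_of_prod (s := univ) hg.continuousOn (mem_univ a)
      (Metric.dist_mem_uniformity (half_pos hε))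
    rw [nhdsWithin_univ] at hv
    filter_upwards [hx.eventually_mem hv] with n hn
    rw [← integral_sub (hintG _ n) (hintG _ n), dist_zero_right]
    have h2 := norm_integral_le_of_norm_le_const (μ := ν n) (C := ε / 2)
      (f := fun y ↦ g (x n) y - g a y) ((hν n).mono fun y hy ↦ by
        rw [← dist_eq_norm]
        exact le_of_lt (hvY _ hn y hy))
    rw [probReal_univ, mul_one] at h2
    exact h2.trans_lt (half_lt_self hε)
  simpa using h1.add h0

/-! ### Conditional beliefs -/

theorem integral_condBelief {d p : ℕ}
    {S : EuclideanSpace ℝ (Fin d) → Set (EuclideanSpace ℝ (Fin p))}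
    {ρ : EuclideanSpace ℝ (Fin d) → EuclideanSpace ℝ (Fin p) → ℝ} {x : EuclideanSpace ℝ (Fin d)}
    (hρ : ∀ y, 0 ≤ ρ x y) (hρc : Continuous (ρ x)) (h0 : μH[(adim (S x) : ℝ)] (S x) ≠ 0)
    (ht : μH[(adim (S x) : ℝ)] (S x) ≠ ⊤) (f : EuclideanSpace ℝ (Fin p) → ℝ) :
    ∫ y, f y ∂condBelief S ρ x =
      (∫ y, ρ x y * f y ∂ProbabilityTheory.cond μH[(adim (S x) : ℝ)] (S x)) /
        ∫ y, ρ x y ∂ProbabilityTheory.cond μH[(adim (S x) : ℝ)] (S x) := by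
  have hc : ((μH[(adim (S x) : ℝ)] (S x))⁻¹).toReal ≠ 0 :=
    (ENNReal.toReal_pos (ENNReal.inv_ne_zero.2 ht) (ENNReal.inv_ne_top.2 h0)).ne'
  rw [condBelief, integral_smul_measure, integral_withDensity_eq_integral_toReal_smul
    (by fun_prop) (Eventually.of_forall fun _ ↦ ENNReal.ofReal_lt_top), ProbabilityTheory.cond,
    integral_smul_measure, integral_smul_measure, smul_eq_mul, smul_eq_mul, smul_eq_mul,
    mul_div_mul_left _ _ hc, integral_eq_lintegral_of_nonneg_ae (f := ρ x)
    (Eventually.of_forall hρ) hρc.aestronglyMeasurable, ENNReal.toReal_inv, div_eq_inv_mul]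
  simp only [ENNReal.toReal_ofReal (hρ _), smul_eq_mul]

theorem tendsto_integral_condBelief {d p : ℕ} {X : Set (EuclideanSpace ℝ (Fin d))}
    {Y : Set (EuclideanSpace ℝ (Fin p))} (hY : IsCompact Y)
    {S : EuclideanSpace ℝ (Fin d) → Set (EuclideanSpace ℝ (Fin p))}
    (hSY : ∀ x ∈ X, S x ⊆ Y) (hSn : ∀ x ∈ X, (S x).Nonempty) (hSconv : ∀ x ∈ X, Convex ℝ (S x))
    (hSc : ∀ x ∈ X, IsCompact (S x))
    {ρ : EuclideanSpace ℝ (Fin d) → EuclideanSpace ℝ (Fin p) → ℝ} (hρ : ∀ x y, 0 ≤ ρ x y)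
    (hρc : Continuous ρ.uncurry) {xb : EuclideanSpace ℝ (Fin d)} (hxb : xb ∈ X)
    (hmass : 0 < ∫⁻ y in S xb, ENNReal.ofReal (ρ xb y) ∂(μH[(adim (S xb) : ℝ)]))
    (hmass' : ∫⁻ y in S xb, ENNReal.ofReal (ρ xb y) ∂(μH[(adim (S xb) : ℝ)]) < ⊤)
    (hrect : RectangularlyContinuousAt X S xb) {x : ℕ → EuclideanSpace ℝ (Fin d)}
    (hx : ∀ n, x n ∈ X) (hlim : Tendsto x atTop (𝓝 xb)) {f : EuclideanSpace ℝ (Fin p) → ℝ}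
    (hf : Continuous f) :
    Tendsto (fun n ↦ ∫ y, f y ∂condBelief S ρ (x n)) atTop (𝓝 (∫ y, f y ∂condBelief S ρ xb)) := by
  have hpos : ∀ z ∈ X, _ := fun z hz ↦
    hausdorffMeasure_adim_pos_lt_top (hSconv z hz) (hSc z hz) (hSn z hz)
  have hprob : ∀ z ∈ X, IsProbabilityMeasure
      (ProbabilityTheory.cond μH[(adim (S z) : ℝ)] (S z)) := fun z hz ↦
    ProbabilityTheory.cond_isProbabilityMeasure_of_finite (hpos z hz).1.ne' (hpos z hz).2.ne
  have hprobx := fun n ↦ hprob _ (hx n)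
  have hprobb := hprob xb hxb
  have hmem : ∀ z ∈ X, ∀ᵐ y ∂ProbabilityTheory.cond μH[(adim (S z) : ℝ)] (S z), y ∈ Y :=
    fun z hz ↦ ProbabilityTheory.ae_cond_of_forall_mem (hSc z hz).measurableSet (hSY z hz)
  have hρz : ∀ z, Continuous (ρ z) := fun z ↦ hρc.comp (Continuous.prodMk_right z)
  have hI : ∀ z ∈ X, _ := fun z hz ↦
    integral_condBelief (hρ z) (hρz z) (hpos z hz).1.ne' (hpos z hz).2.ne f
  have hweak := tendsto_integral_cond_hausdorffMeasure hY hSY hSn hSconv hSc hxb hrect hx hlim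
  have hden : ∫ y, ρ xb y ∂ProbabilityTheory.cond μH[(adim (S xb) : ℝ)] (S xb) ≠ 0 := by
    rw [ProbabilityTheory.cond, integral_smul_measure,
      integral_eq_lintegral_of_nonneg_ae (Eventually.of_forall (hρ xb))
      (hρz xb).aestronglyMeasurable]
    exact smul_ne_zero (ENNReal.toReal_pos (ENNReal.inv_ne_zero.2 (hpos xb hxb).2.ne)
      (ENNReal.inv_ne_top.2 (hpos xb hxb).1.ne')).ne' (ENNReal.toReal_pos hmass.ne' hmass'.ne).ne'
  rw [hI xb hxb]
  refine Tendsto.congr (fun n ↦ (hI _ (hx n)).symm) (Tendsto.div ?_ ?_ hden)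
  · exact tendsto_integral_of_continuous_uncurry (g := fun z y ↦ ρ z y * f y) hY
      (fun n ↦ hmem _ (hx n)) (hmem xb hxb) hweak (hρc.mul (hf.comp continuous_snd)) hlim
  · exact tendsto_integral_of_continuous_uncurry hY
      (fun n ↦ hmem _ (hx n)) (hmem xb hxb) hweak hρc hlim

/-- Theorem 3.12: if `S` is rectangularly continuous at `xb`, then any
conditional belief over `S` with continuous density is weak continuous at `xb`; in
particular the Neutral belief (density `ρ ≡ 1`) is weak continuous at `xb`. -/
theorem stmt_10 {d p : ℕ}
    (X : Set (EuclideanSpace ℝ (Fin d))) (Y : Set (EuclideanSpace ℝ (Fin p)))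
    (hYne : Y.Nonempty) (hYcomp : IsCompact Y)
    (S : EuclideanSpace ℝ (Fin d) → Set (EuclideanSpace ℝ (Fin p)))
    (hSY : ∀ x ∈ X, S x ⊆ Y)
    (hSne : ∀ x ∈ X, (S x).Nonempty)
    (hSconv : ∀ x ∈ X, Convex ℝ (S x))
    (hScomp : ∀ x ∈ X, IsCompact (S x))
    (ρ : EuclideanSpace ℝ (Fin d) → EuclideanSpace ℝ (Fin p) → ℝ)
    (hρnn : ∀ x y, 0 ≤ ρ x y)
    (hρcont : Continuous (fun q : EuclideanSpace ℝ (Fin d) × EuclideanSpace ℝ (Fin p) =>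
      ρ q.1 q.2))
    (hρmass : ∀ x ∈ X, 0 < (∫⁻ y in S x, ENNReal.ofReal (ρ x y) ∂(μH[(adim (S x) : ℝ)])) ∧
      (∫⁻ y in S x, ENNReal.ofReal (ρ x y) ∂(μH[(adim (S x) : ℝ)])) < ⊤)
    (xb : EuclideanSpace ℝ (Fin d)) (hxb : xb ∈ X)
    (hrect : RectangularlyContinuousAt X S xb) :
    (∀ (xseq : ℕ → EuclideanSpace ℝ (Fin d)),
      (∀ n, xseq n ∈ X) → Tendsto xseq atTop (𝓝 xb) →
      ∀ f : EuclideanSpace ℝ (Fin p) → ℝ, Continuous f → (∃ C, ∀ y, |f y| ≤ C) →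
        Tendsto (fun n => ∫ y, f y ∂(condBelief S ρ (xseq n))) atTop
          (𝓝 (∫ y, f y ∂(condBelief S ρ xb)))) ∧
    -- in particular, the Neutral belief over `S` is weak continuous at `xb`
    (∀ (xseq : ℕ → EuclideanSpace ℝ (Fin d)),
      (∀ n, xseq n ∈ X) → Tendsto xseq atTop (𝓝 xb) →
      ∀ f : EuclideanSpace ℝ (Fin p) → ℝ, Continuous f → (∃ C, ∀ y, |f y| ≤ C) →
        Tendsto (fun n => ∫ y, f y ∂(condBelief S (fun _ _ => 1) (xseq n))) atTop
          (𝓝 (∫ y, f y ∂(condBelief S (fun _ _ => 1) xb)))) := by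
  refine ⟨fun x hx hlim f hf _ ↦ tendsto_integral_condBelief hYcomp hSY hSne hSconv hScomp hρnn
    hρcont hxb (hρmass xb hxb).1 (hρmass xb hxb).2 hrect hx hlim hf, fun x hx hlim f hf _ ↦ ?_⟩
  have hpos := hausdorffMeasure_adim_pos_lt_top (hSconv xb hxb) (hScomp xb hxb) (hSne xb hxb)
  refine tendsto_integral_condBelief hYcomp hSY hSne hSconv hScomp (fun _ _ ↦ zero_le_one)
    continuous_const hxb ?_ ?_ hrect hx hlim hf
  · simpa using hpos.1
  · simpa using hpos.2
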